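/- arXiv:math/0410129 — 7 statements merged into one kernel-verified Lean document; each statement's English description precedes it below -/
import Mathlib

section
/- Let G be a finite connected simple graph and let w be a positive goal distribution on G. Then the w-cover pebbling number of G equals the maximum over all vertices v of the sum over all vertices u of w(u)·2^{d(v,u)}, where d(v,u) is the graph distance from v to u. In particular, to determine the w-cover pebbling number it suffices to consider simple initial distributions (all pebbles on a single vertex). -/
/-- A single pebbling move on a graph `G`: remove two pebbles from a vertex `u`
(which must carry at least two pebbles) and add one pebble to a vertex `v`
adjacent to `u`. -/
def SimpleGraph.PebblingMove {V : Type*} (G : SimpleGraph V) (p q : V → ℕ) : Prop :=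
  ∃ u v : V, G.Adj u v ∧ 2 ≤ p u ∧
    q u = p u - 2 ∧ q v = p v + 1 ∧ ∀ x : V, x ≠ u → x ≠ v → q x = p x

/-- A distribution `p` is `w`-solvable if some finite sequence of pebbling moves
starting from `p` reaches a `w`-cover, i.e. a distribution `q` with `q v ≥ w v`
for every vertex `v`. -/
def SimpleGraph.WSolvable {V : Type*} (G : SimpleGraph V) (w p : V → ℕ) : Prop :=
  ∃ q : V → ℕ, Relation.ReflTransGen G.PebblingMove p q ∧ ∀ v : V, w v ≤ q v

/-- The `w`-cover pebbling number of `G`: the least `n` such that every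
distribution of size `n` (total number of pebbles `n`) is `w`-solvable. -/
noncomputable def SimpleGraph.coverPebblingNumber {V : Type*} (G : SimpleGraph V) [Fintype V]
    (w : V → ℕ) : ℕ :=
  sInf {n | ∀ p : V → ℕ, (∑ v, p v) = n → G.WSolvable w p}

namespace SimpleGraph

variable {V : Type*} {G : SimpleGraph V}

/-- Change of a weighted pebble count under a single move from `u` to `v`. -/
lemma sum_mul_add_of_move [Fintype V] {p q : V → ℕ} {u v : V} (huv : u ≠ v) (hp : 2 ≤ p u)
    (hu : q u = p u - 2) (hv : q v = p v + 1) (hq : ∀ x, x ≠ u → x ≠ v → q x = p x)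
    (c : V → ℕ) : ∑ x, q x * c x + 2 * c u = ∑ x, p x * c x + c v := by
  classical
  have h : ∀ x, q x * c x + (if x = u then 2 * c u else 0)
      = p x * c x + (if x = v then c v else 0) := by
    intro x
    by_cases hxu : x = u
    · subst hxu
      obtain ⟨k, hk⟩ := Nat.exists_eq_add_of_le hp
      simp [huv, hu, hk]
      ring
    · by_cases hxv : x = v
      · subst hxv
        simp [hxu, hv]
        ring
      · simp [hxu, hxv, hq x hxu hxv]
  simpa [Finset.sum_add_distrib] using Finset.sum_congr (rfl : Finset.univ = Finset.univ)
    fun x _ => h x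

/-- If `c` at most doubles along every edge, the `c`-weighted pebble count never increases. -/
lemma sum_mul_le_of_reflTransGen [Fintype V] {p q : V → ℕ} {c : V → ℕ}
    (hc : ∀ u v, G.Adj u v → c v ≤ 2 * c u) (h : Relation.ReflTransGen G.PebblingMove p q) :
    ∑ x, q x * c x ≤ ∑ x, p x * c x := by
  induction h with
  | refl => rfl
  | tail _ hmove ih =>
    obtain ⟨u, v, huv, hp, hu, hv, hq⟩ := hmove
    have := sum_mul_add_of_move huv.ne hp hu hv hq c
    have := hc u v huv
    omega

/-- Two pebbles on `u` can be exchanged for one pebble on a neighbour `v`. -/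
lemma exists_pebblingMove {p : V → ℕ} {u v : V} (huv : G.Adj u v) (hp : 2 ≤ p u) :
    ∃ q : V → ℕ, G.PebblingMove p q ∧ q u = p u - 2 ∧ q v = p v + 1 ∧
      ∀ x, x ≠ u → x ≠ v → q x = p x := by
  classical
  refine ⟨Function.update (Function.update p u (p u - 2)) v (p v + 1), ?_⟩
  set q := Function.update (Function.update p u (p u - 2)) v (p v + 1) with hq
  have h1 : q u = p u - 2 := by simp [hq, huv.ne]
  have h2 : q v = p v + 1 := by simp [hq]
  have h3 : ∀ x, x ≠ u → x ≠ v → q x = p x := by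
    intro x hxu hxv
    simp [hq, hxu, hxv]
  exact ⟨⟨u, v, huv, hp, h1, h2, h3⟩, h1, h2, h3⟩

/-- Pushing one extra pebble onto a vertex `t` at level `n + 1` of a level function `δ`, when
all lower vertices are occupied and the vertices at level zero carry at least two pebbles. -/
lemma exists_push_of_level [Fintype V] {p : V → ℕ} {δ : V → ℕ}
    (hδ : ∀ n t, δ t = n + 1 → ∃ x, G.Adj x t ∧ δ x = n) (h0 : ∀ x, δ x = 0 → 2 ≤ p x)
    (n : ℕ) (t : V) (ht : δ t = n + 1) (hpos : ∀ x, δ x < δ t → 1 ≤ p x) :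
    ∃ q : V → ℕ, Relation.ReflTransGen G.PebblingMove p q ∧ q t = p t + 1 ∧
      (∀ y, y ≠ t → q y ≤ p y) ∧ (∀ y, δ t < δ y → q y = p y) ∧
      ∑ y, q y * 2 ^ δ y = ∑ y, p y * 2 ^ δ y ∧ ∑ y, q y < ∑ y, p y := by
  induction n generalizing t with
  | zero =>
    obtain ⟨x, hxt, hx⟩ := hδ 0 t ht
    obtain ⟨q, hmove, h1, h2, h3⟩ := exists_pebblingMove hxt (h0 x hx)
    have hsum := sum_mul_add_of_move hxt.ne (h0 x hx) h1 h2 h3 (fun y => 2 ^ δ y)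
    have hcard := sum_mul_add_of_move hxt.ne (h0 x hx) h1 h2 h3 1
    simp only [Pi.one_apply, mul_one] at hcard
    refine ⟨q, .single hmove, h2, fun y hy => ?_, fun y hy => ?_, ?_, by omega⟩
    · by_cases hyx : y = x
      · subst hyx; omega
      · exact (h3 y hyx hy).le
    · exact h3 y (by rintro rfl; omega) (by rintro rfl; omega)
    · simp only [ht, hx] at hsum
      omega
  | succ n ih =>
    obtain ⟨x, hxt, hx⟩ := hδ _ t ht
    obtain ⟨p₁, hreach, hp₁x, hle, heq, hsum₁, hcard₁⟩ := ih x hx fun y hy => hpos y (by omega)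
    have hpx := hpos x (by omega)
    have hx2 : 2 ≤ p₁ x := by omega
    have hp₁t : p₁ t = p t := heq t (by omega)
    obtain ⟨q, hmove, h1, h2, h3⟩ := exists_pebblingMove hxt hx2
    have hsum := sum_mul_add_of_move hxt.ne hx2 h1 h2 h3 (fun y => 2 ^ δ y)
    have hcard := sum_mul_add_of_move hxt.ne hx2 h1 h2 h3 1
    simp only [Pi.one_apply, mul_one] at hcard
    refine ⟨q, hreach.tail hmove, by omega, fun y hy => ?_, fun y hy => ?_, ?_, by omega⟩
    · by_cases hyx : y = x
      · subst hyx; omega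
      · exact (h3 y hyx hy).trans_le (hle y hyx)
    · rw [h3 y (by rintro rfl; omega) (by rintro rfl; omega), heq y (by omega)]
    · simp only [ht, hx] at hsum
      rw [pow_succ 2 (n + 1)] at hsum
      omega

/-- Distance from a nonempty finite set of vertices. -/
noncomputable def distFrom (G : SimpleGraph V) (F : Finset V) (hF : F.Nonempty) (u : V) : ℕ :=
  F.inf' hF fun f => G.dist f u

lemma distFrom_le {F : Finset V} (hF : F.Nonempty) {f : V} (hf : f ∈ F) (u : V) :
    G.distFrom F hF u ≤ G.dist f u :=
  Finset.inf'_le _ hf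

lemma exists_distFrom_eq {F : Finset V} (hF : F.Nonempty) (u : V) :
    ∃ f ∈ F, G.distFrom F hF u = G.dist f u :=
  Finset.exists_mem_eq_inf' hF _

lemma mem_of_distFrom_eq_zero (hG : G.Connected) {F : Finset V} (hF : F.Nonempty) {u : V}
    (h : G.distFrom F hF u = 0) : u ∈ F := by
  obtain ⟨f, hf, hfu⟩ := exists_distFrom_eq (G := G) hF u
  rw [h] at hfu
  rwa [← hG.dist_eq_zero_iff.1 hfu.symm]

lemma Connected.dist_le_succ_of_adj (hG : G.Connected) {v x y : V} (hxy : G.Adj x y) :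
    G.dist v y ≤ G.dist v x + 1 :=
  hG.dist_triangle.trans_eq (by rw [dist_eq_one_iff_adj.2 hxy])

lemma exists_adj_dist_eq (hG : G.Connected) {f t : V} {n : ℕ} (h : G.dist f t = n + 1) :
    ∃ x, G.Adj x t ∧ G.dist f x = n := by
  obtain ⟨q, hq⟩ := hG.exists_walk_length_eq_dist t f
  cases q with
  | nil => simp at h
  | @cons _ x _ hadj r =>
    have h1 := dist_le r
    rw [Walk.length_cons, dist_comm, h] at hq
    have h2 := hG.dist_le_succ_of_adj (v := f) hadj.symm
    rw [dist_comm] at h1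
    exact ⟨x, hadj.symm, by omega⟩

lemma exists_adj_distFrom_eq (hG : G.Connected) {F : Finset V} (hF : F.Nonempty) (n : ℕ) (t : V)
    (h : G.distFrom F hF t = n + 1) : ∃ x, G.Adj x t ∧ G.distFrom F hF x = n := by
  obtain ⟨f, hf, hft⟩ := exists_distFrom_eq (G := G) hF t
  obtain ⟨x, hxt, hx⟩ := exists_adj_dist_eq hG (hft.symm.trans h)
  obtain ⟨g, hg, hgx⟩ := exists_distFrom_eq (G := G) hF x
  have h1 := distFrom_le (G := G) hF hf x
  have h2 := distFrom_le (G := G) hF hg t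
  have h3 := hG.dist_le_succ_of_adj (v := g) hxt
  exact ⟨x, hxt, by omega⟩

lemma WSolvable.of_le {w p : V → ℕ} (h : ∀ v, w v ≤ p v) : G.WSolvable w p :=
  ⟨p, .refl, h⟩

lemma WSolvable.of_reflTransGen {w p q : V → ℕ}
    (h : Relation.ReflTransGen G.PebblingMove p q) (hq : G.WSolvable w q) : G.WSolvable w p := by
  obtain ⟨r, hr, hw⟩ := hq
  exact ⟨r, h.trans hr, hw⟩

/-- A distribution bounded by the goal and of at least its weighted size covers the goal. -/
lemma WSolvable.of_sum_mul_le [Fintype V] {w p c : V → ℕ} (hc : ∀ v, 0 < c v)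
    (hle : ∀ v, p v ≤ w v) (h : ∑ v, w v * c v ≤ ∑ v, p v * c v) : G.WSolvable w p := by
  refine .of_le fun v => ?_
  by_contra! hv
  exact absurd h (not_le.2 (Finset.sum_lt_sum (fun x _ => Nat.mul_le_mul_right _ (hle x))
    ⟨v, Finset.mem_univ v, Nat.mul_lt_mul_of_pos_right hv (hc v)⟩))

/-- If the pebble count weighted by distances from the set of overfull vertices is at least every
simple cover cost, then the distribution is solvable. -/
theorem WSolvable.of_distFrom_overfull [Fintype V] (hG : G.Connected) {w : V → ℕ}
    (hw : ∀ v, 1 ≤ w v) (p : V → ℕ) (F : Finset V) (hF : F.Nonempty)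
    (hmem : ∀ v, v ∈ F ↔ w v < p v)
    (hsum : ∀ v, ∑ u, w u * 2 ^ G.dist v u ≤ ∑ u, p u * 2 ^ G.distFrom F hF u) :
    G.WSolvable w p := by
  classical
  induction hN : ∑ v, p v using Nat.strong_induction_on generalizing p F with
  | _ N ih =>
  by_cases hthin : ∀ v, w v ≤ p v
  · exact .of_le hthin
  push Not at hthin
  obtain ⟨t, ht, hmin⟩ := Finset.exists_min_image (Finset.univ.filter fun v => p v < w v)
    (G.distFrom F hF) (by simpa [Finset.filter_nonempty_iff] using hthin)
  simp only [Finset.mem_filter, Finset.mem_univ, true_and] at ht hmin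
  have htF : G.distFrom F hF t ≠ 0 := fun h0 => by
    have := (hmem t).1 (mem_of_distFrom_eq_zero hG hF h0)
    omega
  obtain ⟨n, hn⟩ := Nat.exists_eq_succ_of_ne_zero htF
  obtain ⟨q, hreach, hqt, hle, -, hq, hcard⟩ := exists_push_of_level (p := p)
    (exists_adj_distFrom_eq hG hF)
    (fun x hx => by
      have := (hmem x).1 (mem_of_distFrom_eq_zero hG hF hx)
      have := hw x
      omega)
    n t hn
    (fun x hx => by
      by_contra! hlt
      have := hmin x (by have := hw x; omega)
      omega)
  refine .of_reflTransGen hreach ?_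
  have hmono : ∀ F' : Finset V, ∀ hF' : F'.Nonempty, F' ⊆ F → ∀ v,
      ∑ u, w u * 2 ^ G.dist v u ≤ ∑ u, q u * 2 ^ G.distFrom F' hF' u := by
    intro F' hF' hsub v
    refine ((hsum v).trans_eq hq.symm).trans (Finset.sum_le_sum fun u _ => ?_)
    gcongr
    · norm_num
    · exact Finset.inf'_mono _ hsub hF'
  by_cases hfat : ∃ v, w v < q v
  · refine ih _ (hN ▸ hcard) q (Finset.univ.filter fun v => w v < q v)
      (by simpa [Finset.filter_nonempty_iff] using hfat) (by simp) (hmono _ _ fun v hv => ?_) rfl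
    simp only [Finset.mem_filter, Finset.mem_univ, true_and] at hv
    have hvt : v ≠ t := by rintro rfl; omega
    exact (hmem v).2 (hv.trans_le (hle v hvt))
  · push Not at hfat
    obtain ⟨f, hf⟩ := hF
    refine .of_sum_mul_le (c := fun u => 2 ^ G.dist f u) (by simp) hfat ?_
    simpa [distFrom] using hmono {f} (by simp) (by simpa using hf) f

end SimpleGraph

/-- **The cover pebbling theorem.** For a finite connected simple graph `G` and a
positive goal distribution `w`, the `w`-cover pebbling number of `G` equals the
maximum over all vertices `v` of `∑ u, w u * 2 ^ d(v, u)`; in particular it is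
determined by simple initial distributions. -/
theorem cover_pebbling_theorem {V : Type*} [Fintype V]
    (G : SimpleGraph V) (hG : G.Connected) (w : V → ℕ) (hw : ∀ v : V, 1 ≤ w v) :
    G.coverPebblingNumber w =
      Finset.univ.sup (fun v : V => ∑ u : V, w u * 2 ^ G.dist v u) := by
  classical
  set M := Finset.univ.sup (fun v : V => ∑ u : V, w u * 2 ^ G.dist v u)
  have hle : ∀ v, ∑ u, w u * 2 ^ G.dist v u ≤ M := fun v =>
    Finset.le_sup (f := fun v : V => ∑ u : V, w u * 2 ^ G.dist v u) (Finset.mem_univ v)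
  have hsolv : ∀ p : V → ℕ, ∑ v, p v = M → G.WSolvable w p := by
    intro p hp
    by_cases hfat : ∃ v, w v < p v
    · refine .of_distFrom_overfull hG hw p (Finset.univ.filter fun v => w v < p v)
        (by simpa [Finset.filter_nonempty_iff] using hfat) (by simp) fun v => ?_
      refine ((hle v).trans_eq hp.symm).trans (Finset.sum_le_sum fun u _ => ?_)
      exact Nat.le_mul_of_pos_right _ (by positivity)
    · push Not at hfat
      obtain ⟨v⟩ := hG.nonempty
      refine .of_sum_mul_le (c := 1) (by simp) hfat ?_
      simp only [Pi.one_apply, mul_one, hp]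
      exact (Finset.sum_le_sum fun u _ => Nat.le_mul_of_pos_right _ (by positivity)).trans (hle v)
  refine le_antisymm (Nat.sInf_le hsolv) (le_csInf ⟨M, hsolv⟩ fun n hn => ?_)
  refine Finset.sup_le fun v _ => ?_
  obtain ⟨q, hreach, hq⟩ := hn (Pi.single v n) (by simp)
  calc ∑ u, w u * 2 ^ G.dist v u ≤ ∑ u, q u * 2 ^ G.dist v u :=
        Finset.sum_le_sum fun u _ => Nat.mul_le_mul_right _ (hq u)
    _ ≤ ∑ u, (Pi.single v n : V → ℕ) u * 2 ^ G.dist v u := by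
        refine SimpleGraph.sum_mul_le_of_reflTransGen (fun x y hxy => ?_) hreach
        rw [← pow_succ']
        exact Nat.pow_le_pow_right (by norm_num) (hG.dist_le_succ_of_adj hxy)
    _ = n := by simp [Pi.single_apply]
end

section
/- Let G be a finite connected simple graph, let w be a goal distribution on G, and let v be a vertex. If n ≥ Σ_u w(u)·2^{d(v,u)} (the sum over all vertices u, where d(v,u) is the graph distance), then the simple distribution placing n pebbles on v is w-solvable. -/
namespace SimpleGraph

variable {V : Type*} {G : SimpleGraph V}

open Relation

/-- Extra pebbles do not obstruct a pebbling move. -/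
theorem PebblingMove.add_right {p q : V → ℕ} (h : G.PebblingMove p q) (r : V → ℕ) :
    G.PebblingMove (p + r) (q + r) := by
  obtain ⟨u, v, huv, hp, hu, hv, hx⟩ := h
  refine ⟨u, v, huv, ?_, ?_, ?_, fun x hxu hxv => ?_⟩
  · simp only [Pi.add_apply]
    omega
  · simp only [Pi.add_apply]
    omega
  · simp only [Pi.add_apply]
    omega
  · simp only [Pi.add_apply, hx x hxu hxv]

theorem reflTransGen_pebblingMove_add_right {p q : V → ℕ}
    (h : ReflTransGen G.PebblingMove p q) (r : V → ℕ) :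
    ReflTransGen G.PebblingMove (p + r) (q + r) :=
  h.lift (· + r) fun _ _ hm => hm.add_right r

/-- Sequences of pebbling moves can be carried out side by side. -/
theorem reflTransGen_pebblingMove_add {p q p' q' : V → ℕ}
    (h : ReflTransGen G.PebblingMove p q) (h' : ReflTransGen G.PebblingMove p' q') :
    ReflTransGen G.PebblingMove (p + p') (q + q') := by
  refine (reflTransGen_pebblingMove_add_right h p').trans ?_
  rw [add_comm q p', add_comm q q']
  exact reflTransGen_pebblingMove_add_right h' q

theorem reflTransGen_pebblingMove_sum {ι : Type*} (s : Finset ι) {p q : ι → V → ℕ}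
    (h : ∀ i ∈ s, ReflTransGen G.PebblingMove (p i) (q i)) :
    ReflTransGen G.PebblingMove (∑ i ∈ s, p i) (∑ i ∈ s, q i) := by
  classical
  induction s using Finset.induction_on with
  | empty => exact .refl
  | insert a s ha ih =>
    rw [Finset.sum_insert ha, Finset.sum_insert ha]
    exact reflTransGen_pebblingMove_add (h a (Finset.mem_insert_self a s))
      (ih fun i hi => h i (Finset.mem_insert_of_mem hi))

variable [DecidableEq V]

theorem Adj.pebblingMove_single {u v : V} (h : G.Adj u v) :
    G.PebblingMove (Pi.single u 2) (Pi.single v 1) := by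
  refine ⟨u, v, h, ?_, ?_, ?_, fun x hxu hxv => ?_⟩
  · simp
  · simp [h.ne]
  · simp [h.ne']
  · simp [hxu, hxv]

theorem Adj.reflTransGen_pebblingMove_single {u v : V} (h : G.Adj u v) (k : ℕ) :
    ReflTransGen G.PebblingMove (Pi.single u (k * 2)) (Pi.single v k) := by
  induction k with
  | zero => simpa using ReflTransGen.refl
  | succ k ih =>
    rw [add_one_mul, Pi.single_add, Pi.single_add]
    exact reflTransGen_pebblingMove_add ih (.single h.pebblingMove_single)

/-- Along a walk of length `l`, `k * 2 ^ l` pebbles can be turned into `k` pebbles at the end. -/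
theorem Walk.reflTransGen_pebblingMove_single {u v : V} (W : G.Walk u v) (k : ℕ) :
    ReflTransGen G.PebblingMove (Pi.single u (k * 2 ^ W.length)) (Pi.single v k) := by
  induction W with
  | nil => simpa using ReflTransGen.refl
  | cons h W ih =>
    rw [Walk.length_cons, pow_succ, ← mul_assoc]
    exact (h.reflTransGen_pebblingMove_single _).trans ih

theorem Connected.reflTransGen_pebblingMove_single (hG : G.Connected) (u v : V) (k : ℕ) :
    ReflTransGen G.PebblingMove (Pi.single u (k * 2 ^ G.dist u v)) (Pi.single v k) := by
  obtain ⟨W, hW⟩ := hG.exists_walk_length_eq_dist u v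
  exact hW ▸ W.reflTransGen_pebblingMove_single k

end SimpleGraph

/-- If `n` is at least the cost of cover pebbling from `v`, namely
`∑ u, w u * 2 ^ d(v, u)`, then the simple distribution placing `n` pebbles on
`v` is `w`-solvable. -/
theorem simple_distribution_solvable_of_cost_le {V : Type*} [Fintype V] [DecidableEq V]
    (G : SimpleGraph V) (hG : G.Connected) (w : V → ℕ) (v : V) (n : ℕ)
    (hn : ∑ u, w u * 2 ^ G.dist v u ≤ n) :
    G.WSolvable w (fun x => if x = v then n else 0) := by
  have h := SimpleGraph.reflTransGen_pebblingMove_add_right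
    (SimpleGraph.reflTransGen_pebblingMove_sum Finset.univ fun u _ =>
      hG.reflTransGen_pebblingMove_single v u (w u))
    (Pi.single v (n - ∑ u, w u * 2 ^ G.dist v u))
  have hp : (∑ u, Pi.single v (w u * 2 ^ G.dist v u)) +
      Pi.single v (n - ∑ u, w u * 2 ^ G.dist v u) = fun x => if x = v then n else 0 := by
    funext x
    rw [Pi.add_apply, Finset.sum_apply]
    by_cases hx : x = v
    · subst hx
      simp only [Pi.single_eq_same, if_true]
      omega
    · simp [hx]
  rw [hp, Finset.univ_sum_single] at h
  exact ⟨_, h, fun u => Nat.le_add_right _ _⟩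
end

section
/- Let G be a finite connected simple graph, let w be a goal distribution on G, and let v be a vertex. If the simple distribution placing n pebbles on v is w-solvable, then n ≥ Σ_u w(u)·2^{d(v,u)} (the sum over all vertices u, where d(v,u) is the graph distance). In other words, the cost of cover pebbling from v, namely Σ_u w(u)·2^{d(v,u)}, is a lower bound on the number of pebbles needed on v. -/
namespace SimpleGraph

/-- A pebbling move does not increase the sum of the pebbles weighted by `2 ^ d(r, ·)`. -/
theorem PebblingMove.sum_mul_two_pow_dist_le {V : Type*} [Fintype V] {G : SimpleGraph V}
    (hG : G.Connected) (r : V) {p q : V → ℕ} (h : G.PebblingMove p q) :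
    ∑ x, q x * 2 ^ G.dist r x ≤ ∑ x, p x * 2 ^ G.dist r x := by
  classical
  obtain ⟨a, b, hab, hpa, hqa, hqb, hq⟩ := h
  have hb : b ∈ Finset.univ.erase a := by simp [hab.ne']
  have hrest : ∑ x ∈ (Finset.univ.erase a).erase b, q x * 2 ^ G.dist r x =
      ∑ x ∈ (Finset.univ.erase a).erase b, p x * 2 ^ G.dist r x := by
    refine Finset.sum_congr rfl fun x hx => ?_
    simp only [Finset.mem_erase, Finset.mem_univ, and_true] at hx
    rw [hq x hx.2 hx.1]
  have hdist : G.dist r b ≤ G.dist r a + 1 := by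
    simpa [SimpleGraph.dist_eq_one_iff_adj.mpr hab] using
      hG.dist_triangle (u := r) (v := a) (w := b)
  have hpow : 2 ^ G.dist r b ≤ 2 * 2 ^ G.dist r a := by
    rw [← pow_succ']
    exact Nat.pow_le_pow_right two_pos hdist
  rw [← Finset.add_sum_erase _ _ (Finset.mem_univ a), ← Finset.add_sum_erase _ _ hb,
    ← Finset.add_sum_erase _ (fun x => p x * _) (Finset.mem_univ a),
    ← Finset.add_sum_erase _ (fun x => p x * _) hb, hrest, hqa, hqb]
  obtain ⟨k, hk⟩ := Nat.exists_eq_add_of_le hpa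
  rw [hk, Nat.add_sub_cancel_left]
  nlinarith

end SimpleGraph

/-- The cost of cover pebbling from `v`, namely `∑ u, w u * 2 ^ d(v, u)`, is a
lower bound on the number of pebbles needed on `v`: if the simple distribution
placing `n` pebbles on `v` is `w`-solvable, then `n ≥ ∑ u, w u * 2 ^ d(v, u)`. -/
theorem cost_le_of_simple_distribution_solvable {V : Type*} [Fintype V] [DecidableEq V]
    (G : SimpleGraph V) (hG : G.Connected) (w : V → ℕ) (v : V) (n : ℕ)
    (hn : G.WSolvable w (fun x => if x = v then n else 0)) :
    ∑ u : V, w u * 2 ^ G.dist v u ≤ n := by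
  obtain ⟨q, hq, hw⟩ := hn
  have hmono : ∑ u, q u * 2 ^ G.dist v u ≤
      ∑ u, (if u = v then n else 0) * 2 ^ G.dist v u := by
    clear hw
    induction hq with
    | refl => exact le_rfl
    | tail _ hmove ih => exact (hmove.sum_mul_two_pow_dist_le hG v).trans ih
  calc ∑ u, w u * 2 ^ G.dist v u
      ≤ ∑ u, q u * 2 ^ G.dist v u :=
        Finset.sum_le_sum fun u _ => Nat.mul_le_mul_right _ (hw u)
    _ ≤ ∑ u, (if u = v then n else 0) * 2 ^ G.dist v u := hmono
    _ = n := by simp [ite_mul]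
end

section
/- Let G be a finite connected simple graph and let w be a positive goal distribution on G. Every distribution of pebbles on G whose size is at least max_v Σ_u w(u)·2^{d(v,u)} (the maximum over all vertices v of the sum over all vertices u, where d(v,u) is the graph distance) is w-solvable. -/
open Classical in
theorem SimpleGraph.exists_pebblingMove_s5 {V : Type*} [Fintype V] {G : SimpleGraph V} {p : V → ℕ}
    {u v : V} (h : G.Adj u v) (hu : 2 ≤ p u) :
    ∃ q : V → ℕ, G.PebblingMove p q ∧ q u + 2 = p u ∧ q v = p v + 1 ∧
      (∀ x, x ≠ u → x ≠ v → q x = p x) ∧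
      ∀ m : V → ℕ, ∑ x, q x * m x + 2 * m u = ∑ x, p x * m x + m v := by
  have hne : u ≠ v := h.ne
  obtain ⟨q, hq⟩ : ∃ q : V → ℕ, ∀ x,
      q x + (if x = u then 2 else 0) = p x + (if x = v then 1 else 0) := by
    refine ⟨fun x => p x + (if x = v then 1 else 0) - (if x = u then 2 else 0), fun x => ?_⟩
    by_cases hx : x = u
    · subst hx
      simp only [if_true]
      omega
    · simp [hx]
  have hqu : q u + 2 = p u := by simpa [hne] using hq u
  have hqv : q v = p v + 1 := by simpa [hne.symm] using hq v
  have hqx : ∀ x, x ≠ u → x ≠ v → q x = p x := fun x h₁ h₂ => by simpa [h₁, h₂] using hq x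
  refine ⟨q, ⟨u, v, h, hu, by omega, hqv, hqx⟩, hqu, hqv, hqx, fun m => ?_⟩
  have key : ∑ x, (q x + (if x = u then 2 else 0)) * m x =
      ∑ x, (p x + (if x = v then 1 else 0)) * m x :=
    Finset.sum_congr rfl fun x _ => by rw [hq x]
  simpa [add_mul, Finset.sum_add_distrib, ite_mul] using key

theorem SimpleGraph.Connected.exists_adj_dist_eq {V : Type*} {G : SimpleGraph V}
    (hG : G.Connected) {f t : V} {k : ℕ} (h : G.dist f t = k + 1) :
    ∃ x, G.Adj x t ∧ G.dist f x = k := by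
  obtain ⟨W, hW⟩ := hG.exists_walk_length_eq_dist t f
  rw [SimpleGraph.dist_comm, h] at hW
  cases W with
  | nil => simp at hW
  | @cons _ x _ hadj W' =>
    rw [SimpleGraph.Walk.length_cons] at hW
    have h₁ := SimpleGraph.dist_le W'
    have h₂ := hG.dist_triangle (u := f) (v := x) (w := t)
    rw [SimpleGraph.dist_comm] at h₁
    rw [SimpleGraph.dist_eq_one_iff_adj.2 hadj.symm] at h₂
    exact ⟨x, hadj.symm, by omega⟩

/-- If `f` carries two pebbles and every vertex closer to `f` than `t` carries a pebble, then a
pebble can be moved along a geodesic from `f` to `t`, using up one pebble from each interior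
vertex. -/
theorem SimpleGraph.Connected.exists_geodesic_pebbling {V : Type*} [Fintype V]
    {G : SimpleGraph V} (hG : G.Connected) {q : V → ℕ} {f : V} (hf : 2 ≤ q f) (k : ℕ) :
    ∀ t : V, G.dist f t = k + 1 → (∀ u, G.dist f u < k + 1 → 1 ≤ q u) →
      ∃ q' : V → ℕ, Relation.ReflTransGen G.PebblingMove q q' ∧ q' t = q t + 1 ∧
        (∀ u, u ≠ t → q' u ≤ q u) ∧
        (∀ u, u ≠ t → k + 1 ≤ G.dist f u → q' u = q u) ∧
        ∑ u, q' u < ∑ u, q u ∧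
        ∀ m : V → ℕ, (∀ u, m u ≤ 2 ^ G.dist f u) →
          ∑ u, q u * m u + m t ≤ ∑ u, q' u * m u + 2 ^ (k + 1) := by
  induction k with
  | zero =>
    intro t ht _
    obtain ⟨q', hmove, hqf, hqt, hqx, hsum⟩ :=
      SimpleGraph.exists_pebblingMove_s5 (SimpleGraph.dist_eq_one_iff_adj.1 ht) hf
    refine ⟨q', .single hmove, hqt, fun u hu => ?_, fun u hu hd => ?_, ?_, fun m hm => ?_⟩
    · by_cases h : u = f
      · subst h; omega
      · exact (hqx u h hu).le
    · refine hqx u (fun h => ?_) hu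
      subst h
      simp at hd
    · have := hsum fun _ => 1
      simp only [mul_one] at this
      omega
    · have h₁ := hsum m
      have h₂ := hm f
      simp only [SimpleGraph.dist_self, pow_zero] at h₂
      omega
  | succ k ih =>
    intro t ht hpos
    obtain ⟨x, hadj, hx⟩ := hG.exists_adj_dist_eq ht
    obtain ⟨q₁, hreach, h₁x, h₁le, h₁eq, h₁size, h₁m⟩ :=
      ih x hx fun u hu => hpos u (by omega)
    have hxpos := hpos x (by omega)
    obtain ⟨q', hmove, hqx, hqt, hq, hsum⟩ :=
      SimpleGraph.exists_pebblingMove_s5 (p := q₁) hadj (by omega)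
    have htx : t ≠ x := hadj.ne'
    refine ⟨q', hreach.tail hmove, ?_, fun u hu => ?_, fun u hu hd => ?_, ?_, fun m hm => ?_⟩
    · rw [hqt, h₁eq t htx (by omega)]
    · by_cases h : u = x
      · subst h; omega
      · rw [hq u h hu]
        exact h₁le u h
    · have h : u ≠ x := by
        rintro rfl
        omega
      rw [hq u h hu, h₁eq u h (by omega)]
    · have := hsum fun _ => 1
      simp only [mul_one] at this
      omega
    · have h₁ := hsum m
      have h₂ := h₁m m hm
      have h₃ := hm x
      rw [hx] at h₃
      rw [pow_succ 2 (k + 1)]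
      omega

/-- The weight `m u` bounds the value of each pebble on `u`, where a pebble created by a move has
as value the sum of the values of the two removed pebbles. -/
theorem SimpleGraph.Connected.wSolvable_of_weight {V : Type*} [Fintype V]
    {G : SimpleGraph V} (hG : G.Connected) {w : V → ℕ} (hw : ∀ v, 1 ≤ w v) {N : ℕ}
    (hN : ∀ v, ∑ u, w u * 2 ^ G.dist v u ≤ N) (n : ℕ) :
    ∀ q : V → ℕ, ∑ u, q u = n →
      ∀ m : V → ℕ, (∀ f, w f < q f → ∀ u, m u ≤ 2 ^ G.dist f u) →
      (∃ f, ∀ u, m u ≤ 2 ^ G.dist f u) → N ≤ ∑ u, q u * m u → G.WSolvable w q := by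
  classical
  induction n using Nat.strong_induction_on with
  | _ n ih =>
  intro q hqn m hm ⟨f₀, hf₀⟩ hNq
  by_cases hfat : ∃ f, w f < q f
  · by_cases hthin : ∃ t, q t < w t
    · obtain ⟨⟨f, t⟩, ⟨hf, ht⟩, hmin⟩ :
          ∃ x : V × V, (w x.1 < q x.1 ∧ q x.2 < w x.2) ∧
            ∀ y : V × V, w y.1 < q y.1 ∧ q y.2 < w y.2 → G.dist x.1 x.2 ≤ G.dist y.1 y.2 := by
        obtain ⟨f, hf⟩ := hfat
        obtain ⟨t, ht⟩ := hthin
        obtain ⟨x, hx, hx'⟩ := Finset.exists_min_image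
          (Finset.univ.filter fun x : V × V => w x.1 < q x.1 ∧ q x.2 < w x.2)
          (fun x => G.dist x.1 x.2) ⟨(f, t), by simp [hf, ht]⟩
        exact ⟨x, by simpa using hx, fun y hy => hx' y (by simpa using hy)⟩
      simp only [Prod.forall] at hf ht hmin
      have hne : f ≠ t := by
        rintro rfl
        omega
      obtain ⟨k, hk⟩ : ∃ k, G.dist f t = k + 1 :=
        ⟨G.dist f t - 1, by have := hG.pos_dist_of_ne hne; omega⟩
      have hwf := hw f
      obtain ⟨q', hreach, hq't, hq'le, -, hsize, hq'm⟩ :=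
        hG.exists_geodesic_pebbling (q := q) (f := f) (by omega) k t hk (fun u hu => by
          by_contra hu0
          have h₁ := hw u
          have h₂ := hmin f u ⟨hf, by omega⟩
          omega)
      have hfat' : ∀ g, w g < q' g → w g < q g := by
        intro g hg
        by_cases hgt : g = t
        · subst hgt; omega
        · exact hg.trans_le (hq'le g hgt)
      have hbound : ∀ g, w g < q g → ∀ u,
          Function.update m t (2 ^ (k + 1)) u ≤ 2 ^ G.dist g u := by
        intro g hg u
        by_cases hut : u = t
        · subst hut
          rw [Function.update_self]
          exact Nat.pow_le_pow_right (by norm_num) (hk ▸ hmin g u ⟨hg, ht⟩)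
        · rw [Function.update_of_ne hut]
          exact hm g hg u
      obtain ⟨r, hr, hrw⟩ := ih _ (hqn ▸ hsize) q' rfl (Function.update m t (2 ^ (k + 1)))
        (fun g hg => hbound g (hfat' g hg)) ⟨f, hbound f hf⟩ (by
          have h₁ := hq'm m (hm f hf)
          have hmt : m t ≤ 2 ^ (k + 1) := hk ▸ hm f hf t
          have h₂ := Finset.add_sum_erase Finset.univ (fun u => q' u * m u) (Finset.mem_univ t)
          have h₃ := Finset.add_sum_erase Finset.univ
            (fun u => q' u * Function.update m t (2 ^ (k + 1)) u) (Finset.mem_univ t)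
          have h₄ : ∑ u ∈ Finset.univ.erase t, q' u * Function.update m t (2 ^ (k + 1)) u =
              ∑ u ∈ Finset.univ.erase t, q' u * m u :=
            Finset.sum_congr rfl fun u hu => by
              rw [Function.update_of_ne (Finset.ne_of_mem_erase hu)]
          have h₅ := Nat.mul_le_mul_left (q t) hmt
          simp only [Function.update_self, h₄, hq't, add_mul, one_mul] at h₂ h₃
          omega)
      exact ⟨r, hreach.trans hr, hrw⟩
    · push Not at hthin
      exact ⟨q, .refl, hthin⟩
  · push Not at hfat
    refine ⟨q, .refl, fun t => ?_⟩
    by_contra! ht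
    have h₁ : ∑ u, q u * m u ≤ ∑ u, q u * 2 ^ G.dist f₀ u :=
      Finset.sum_le_sum fun u _ => Nat.mul_le_mul_left _ (hf₀ u)
    have h₂ : ∑ u, q u * 2 ^ G.dist f₀ u < ∑ u, w u * 2 ^ G.dist f₀ u :=
      Finset.sum_lt_sum (fun u _ => Nat.mul_le_mul_right _ (hfat u))
        ⟨t, Finset.mem_univ t, Nat.mul_lt_mul_of_pos_right ht (by positivity)⟩
    have h₃ := hN f₀
    omega

/-- Every distribution whose size is at least
`max_v ∑ u, w u * 2 ^ d(v, u)` is `w`-solvable. -/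
theorem wSolvable_of_size_ge_max_cost {V : Type*} [Fintype V]
    (G : SimpleGraph V) (hG : G.Connected) (w : V → ℕ) (hw : ∀ v : V, 1 ≤ w v)
    (p : V → ℕ)
    (hp : Finset.univ.sup (fun v : V => ∑ u : V, w u * 2 ^ G.dist v u) ≤ ∑ v : V, p v) :
    G.WSolvable w p := by
  have := hG.nonempty
  exact hG.wSolvable_of_weight hw
    (fun v => (Finset.le_sup (f := fun v : V => ∑ u : V, w u * 2 ^ G.dist v u)
      (Finset.mem_univ v)).trans hp) _ p rfl (fun _ => 1)
    (fun _ _ _ => Nat.one_le_two_pow) ⟨Classical.arbitrary V, fun _ => Nat.one_le_two_pow⟩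
    (by simp)
end

section
/- For n ≥ 1, the cover pebbling number of the path graph on n vertices equals 2^n − 1. -/
namespace SimpleGraph

/-- Repeating a pebbling move `j` times along the same edge. -/
theorem reflTransGen_pebblingMove_of_adj {V : Type*} {G : SimpleGraph V} {u v : V}
    (huv : G.Adj u v) (j : ℕ) {p q : V → ℕ} (hu : p u = q u + 2 * j) (hv : q v = p v + j)
    (h : ∀ x, x ≠ u → x ≠ v → q x = p x) : Relation.ReflTransGen G.PebblingMove p q := by
  classical
  induction j generalizing p with
  | zero =>
    have hpq : p = q := by
      funext x
      by_cases hxu : x = u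
      · subst hxu; omega
      by_cases hxv : x = v
      · subst hxv; omega
      exact (h x hxu hxv).symm
    rw [hpq]
  | succ j ih =>
    have hne : v ≠ u := huv.ne'
    refine Relation.ReflTransGen.head
      (b := Function.update (Function.update p u (p u - 2)) v (p v + 1)) ?_ (ih ?_ ?_ ?_)
    · refine ⟨u, v, huv, by omega, ?_, by simp, ?_⟩
      · simp [hne.symm]
      · intro x hxu hxv
        simp [hxu, hxv]
    · simp [hne.symm]
      omega
    · simp
      omega
    · intro x hxu hxv
      simp [hxu, hxv, h x hxu hxv]

theorem PebblingMove.cons {m : ℕ} {p q : Fin m → ℕ} (a : ℕ)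
    (h : (pathGraph m).PebblingMove p q) :
    (pathGraph (m + 1)).PebblingMove (Fin.cons a p : Fin (m + 1) → ℕ) (Fin.cons a q) := by
  obtain ⟨u, v, huv, h2, hu, hv, hx⟩ := h
  refine ⟨u.succ, v.succ, ?_, by simpa using h2, by simpa using hu, by simpa using hv, ?_⟩
  · rw [pathGraph_adj] at huv ⊢
    simpa using huv
  · intro x
    refine Fin.cases ?_ (fun y => ?_) x
    · simp
    · intro h1 h2
      simpa using hx y (by simpa using h1) (by simpa using h2)

theorem reflTransGen_pebblingMove_cons {m : ℕ} {p q : Fin m → ℕ} (a : ℕ)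
    (h : Relation.ReflTransGen (pathGraph m).PebblingMove p q) :
    Relation.ReflTransGen (pathGraph (m + 1)).PebblingMove
      (Fin.cons a p : Fin (m + 1) → ℕ) (Fin.cons a q) :=
  h.lift (fun p => (Fin.cons a p : Fin (m + 1) → ℕ)) fun _ _ => PebblingMove.cons a

/-- On the path with `n + 1` vertices, any `(j + 2) * 2 ^ n - 1` pebbles suffice to cover every
vertex with one pebble and the first vertex with `j + 1` pebbles. -/
theorem exists_reflTransGen_pathGraph_cover (n : ℕ) (j : ℕ) (p : Fin (n + 1) → ℕ)
    (hp : (j + 2) * 2 ^ n ≤ ∑ v, p v + 1) :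
    ∃ q, Relation.ReflTransGen (pathGraph (n + 1)).PebblingMove p q ∧
      j + 1 ≤ q 0 ∧ ∀ v, 1 ≤ q v := by
  induction n generalizing j with
  | zero =>
    simp at hp
    refine ⟨p, .refl, by omega, fun v => ?_⟩
    obtain rfl : v = 0 := Fin.fin_one_eq_zero v
    omega
  | succ n ih =>
    have hadj : (pathGraph (n + 2)).Adj 0 (Fin.succ 0) := by simp [pathGraph_adj]
    obtain ⟨a, r, rfl⟩ : ∃ (a : ℕ) (r : Fin (n + 1) → ℕ), p = Fin.cons a r :=
      ⟨p 0, Fin.tail p, (Fin.cons_self_tail p).symm⟩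
    rw [Fin.sum_univ_succ] at hp
    simp only [Fin.cons_zero, Fin.cons_succ] at hp
    have hpos : 1 ≤ 2 ^ n := Nat.one_le_two_pow
    by_cases ha : j + 1 ≤ a
    · obtain ⟨t, b, hab, hb, hb'⟩ : ∃ t b, a = b + 2 * t ∧ j + 1 ≤ b ∧ b ≤ j + 2 :=
        ⟨(a - (j + 1)) / 2, a - 2 * ((a - (j + 1)) / 2), by omega, by omega, by omega⟩
      have hsum : ∑ v, Function.update r 0 (r 0 + t) v = ∑ v, r v + t := by
        simp only [Fin.sum_univ_succ, Function.update_self, ne_eq, Fin.succ_ne_zero,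
          not_false_eq_true, Function.update_of_ne]
        omega
      obtain ⟨q, hq, -, hq1⟩ := ih 0 (Function.update r 0 (r 0 + t)) (by
        rw [hsum]
        have : j ≤ j * 2 ^ n := Nat.le_mul_of_pos_right _ hpos
        rw [pow_succ, show (j + 2) * (2 ^ n * 2) = 2 * (j * 2 ^ n) + 4 * 2 ^ n by ring] at hp
        omega)
      refine ⟨Fin.cons b q, .trans (reflTransGen_pebblingMove_of_adj hadj t ?_ ?_ ?_)
        (reflTransGen_pebblingMove_cons b hq), by simpa using hb, ?_⟩
      · simpa using hab
      · simp
      · intro x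
        refine Fin.cases (by simp) (fun y => ?_) x
        intro _ hy
        have : y ≠ 0 := fun h => hy (by rw [h])
        simp [this]
      · intro v
        refine Fin.cases ?_ (fun y => ?_) v
        · simp; omega
        · simpa using hq1 y
    · obtain ⟨d, hd⟩ : ∃ d, j + 1 = a + d := ⟨j + 1 - a, by omega⟩
      obtain ⟨q, hq, hq0, hq1⟩ := ih (2 * d) r (by
        have : a ≤ a * 2 ^ n := Nat.le_mul_of_pos_right _ hpos
        rw [show j + 2 = a + d + 1 by omega, pow_succ,
          show (a + d + 1) * (2 ^ n * 2) = 2 * (a * 2 ^ n) + (2 * d + 2) * 2 ^ n by ring] at hp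
        omega)
      refine ⟨Fin.cons (a + d) (Function.update q 0 (q 0 - 2 * d)),
        .trans (reflTransGen_pebblingMove_cons a hq)
          (reflTransGen_pebblingMove_of_adj hadj.symm d ?_ ?_ ?_), by simp; omega, ?_⟩
      · simp; omega
      · simp
      · intro x
        refine Fin.cases (by simp) (fun y => ?_) x
        intro hy _
        have : y ≠ 0 := fun h => hy (by rw [h])
        simp [this]
      · intro v
        refine Fin.cases ?_ (fun y => ?_) v
        · simp; omega
        · by_cases hy : y = 0
          · subst hy; simp; omega
          · simpa [hy] using hq1 y

theorem PebblingMove.sum_mul_two_pow_le {m : ℕ} {p q : Fin m → ℕ}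
    (h : (pathGraph m).PebblingMove p q) :
    ∑ v, q v * 2 ^ (v : ℕ) ≤ ∑ v, p v * 2 ^ (v : ℕ) := by
  obtain ⟨u, v, huv, h2, hu, hv, hx⟩ := h
  have hvu : v ∈ Finset.univ.erase u := by simp [huv.ne']
  rw [← Finset.add_sum_erase _ _ (Finset.mem_univ u), ← Finset.add_sum_erase _ _ hvu,
    ← Finset.add_sum_erase _ (fun v => p v * 2 ^ (v : ℕ)) (Finset.mem_univ u),
    ← Finset.add_sum_erase _ (fun v => p v * 2 ^ (v : ℕ)) hvu]
  have hrest : ∑ x ∈ (Finset.univ.erase u).erase v, q x * 2 ^ (x : ℕ) =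
      ∑ x ∈ (Finset.univ.erase u).erase v, p x * 2 ^ (x : ℕ) := by
    refine Finset.sum_congr rfl fun x hxm => ?_
    simp only [Finset.mem_erase, Finset.mem_univ, and_true] at hxm
    rw [hx x hxm.2 hxm.1]
  have hpow : 2 ^ (v : ℕ) ≤ 2 * 2 ^ (u : ℕ) := by
    rw [← pow_succ']
    rw [pathGraph_adj] at huv
    exact Nat.pow_le_pow_right two_pos (by omega)
  obtain ⟨c, hc⟩ := Nat.exists_eq_add_of_le h2
  have huc : q u = c := by omega
  rw [hrest, hv, huc, hc]
  linarith

end SimpleGraph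

/-- The cover pebbling number of the path graph on `n ≥ 1` vertices is `2^n - 1`. -/
theorem coverPebblingNumber_pathGraph (n : ℕ) (hn : 1 ≤ n) :
    (SimpleGraph.pathGraph n).coverPebblingNumber (fun _ => 1) = 2 ^ n - 1 := by
  obtain ⟨m, rfl⟩ := Nat.exists_eq_add_of_le' hn
  have hpos : 1 ≤ 2 ^ (m + 1) := Nat.one_le_two_pow
  refine IsLeast.csInf_eq ⟨fun p hp => ?_, fun k hk => ?_⟩
  · obtain ⟨q, hq, -, hq1⟩ := SimpleGraph.exists_reflTransGen_pathGraph_cover m 0 p (by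
      rw [hp, pow_succ] at *
      omega)
    exact ⟨q, hq, hq1⟩
  · obtain ⟨q, hq, hq1⟩ := hk (Pi.single 0 k) (by simp)
    have hle : ∑ v, q v * 2 ^ (v : ℕ) ≤
        ∑ v, (Pi.single 0 k : Fin (m + 1) → ℕ) v * 2 ^ (v : ℕ) := by
      clear hq1
      induction hq with
      | refl => exact le_rfl
      | tail _ h ih => exact h.sum_mul_two_pow_le.trans ih
    have hk' : ∑ v, (Pi.single 0 k : Fin (m + 1) → ℕ) v * 2 ^ (v : ℕ) = k := by
      simp [Fin.sum_univ_succ]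
    have hcover : ∑ v : Fin (m + 1), 2 ^ (v : ℕ) ≤ ∑ v, q v * 2 ^ (v : ℕ) :=
      Finset.sum_le_sum fun v _ => Nat.le_mul_of_pos_left _ (hq1 v)
    rw [Fin.sum_univ_eq_sum_range (fun i => 2 ^ i), Nat.geomSum_eq le_rfl] at hcover
    omega
end

section
/- For n ≥ 2, the cover pebbling number of the cycle graph on 2n−1 vertices equals 2^{n+1} − 3. -/
open Finset

namespace SimpleGraph

variable {V : Type*} {G : SimpleGraph V}

/-- A pebble can be pushed along a path all of whose vertices but the last are occupied: the net
effect is that every vertex of the path but the last loses a pebble and the last one gains one. -/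
theorem Walk.IsPath.reflTransGen_pebblingMove [DecidableEq V] {a t : V} {W : G.Walk a t}
    (hW : W.IsPath) (p : V → ℕ) (hp : ∀ u ∈ W.support, u ≠ t → 1 ≤ p u) :
    Relation.ReflTransGen G.PebblingMove (fun u => if u = a then p u + 1 else p u)
      (fun u => if u = t then p u + 1 else if u ∈ W.support then p u - 1 else p u) := by
  induction W generalizing p with
  | nil =>
    convert Relation.ReflTransGen.refl using 2 with u
    split_ifs <;> simp_all
  | @cons a b t hab W ih =>
    rw [Walk.cons_isPath_iff] at hW
    have hat : a ≠ t := fun h => hW.2 (h ▸ W.end_mem_support)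
    have hpa : 1 ≤ p a := hp a (by simp) hat
    have key := ih hW.1 (fun u => if u = a then p u - 1 else p u) (by
      intro u hu hut
      have hua : u ≠ a := fun h => hW.2 (h ▸ hu)
      simpa [hua] using hp u (by simp [hu]) hut)
    refine Relation.ReflTransGen.head ?_ (b := _) (key.trans ?_)
    · refine ⟨a, b, hab, ?_, ?_, ?_, ?_⟩
      · simp; omega
      · simp [hab.ne]
      · simp [hab.ne']
      · intro x hxa hxb
        simp [hxa, hxb]
    · convert Relation.ReflTransGen.refl using 2 with u
      have hW2 := hW.2
      by_cases hua : u = a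
      · subst hua
        simp [hat, hW2]
      · simp [hua]

/-- The pebbles of a path are worth at most a geometric sum: if the cost of a vertex is at most
`2 ^ dist` to the start of a path, the interior of the path costs at most `2 ^ length - 2`. -/
theorem Walk.sum_interior_add_two_le [DecidableEq V] {g t : V} (W : G.Walk g t) (hgt : g ≠ t)
    (c : V → ℕ) (hc : ∀ u ∈ W.support, u ≠ g → u ≠ t → c u ≤ 2 ^ G.dist u g) :
    ∑ u ∈ W.support.toFinset \ {g, t}, c u + 2 ≤ 2 ^ W.length := by
  have hlen : 1 ≤ W.length := by
    rcases Nat.eq_zero_or_pos W.length with h | h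
    · exact absurd (W.eq_of_length_eq_zero h) hgt
    · exact h
  have hsub : W.support.toFinset \ {g, t} ⊆ (Ico 1 W.length).image W.getVert := by
    intro u hu
    simp only [mem_sdiff, List.mem_toFinset, mem_insert, mem_singleton, not_or] at hu
    obtain ⟨hu, hug, hut⟩ := hu
    obtain ⟨i, rfl, hi⟩ := Walk.mem_support_iff_exists_getVert.1 hu
    refine mem_image.2 ⟨i, mem_Ico.2 ⟨?_, ?_⟩, rfl⟩
    · rcases Nat.eq_zero_or_pos i with rfl | h
      · simp at hug
      · exact h
    · rcases hi.lt_or_eq with h | rfl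
      · exact h
      · simp at hut
  choose! j hj using fun u (hu : u ∈ W.support.toFinset \ {g, t}) => mem_image.1 (hsub hu)
  have hinj : Set.InjOn j (W.support.toFinset \ {g, t} : Finset V) := by
    intro u hu v hv huv
    rw [← (hj u hu).2, ← (hj v hv).2, huv]
  have hle : ∑ u ∈ W.support.toFinset \ {g, t}, c u ≤ ∑ i ∈ Ico 1 W.length, 2 ^ i := by
    calc ∑ u ∈ W.support.toFinset \ {g, t}, c u
        ≤ ∑ u ∈ W.support.toFinset \ {g, t}, 2 ^ j u := by
          refine sum_le_sum fun u hu => ?_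
          have hu' := hu
          simp only [mem_sdiff, List.mem_toFinset, mem_insert, mem_singleton, not_or] at hu'
          refine (hc u hu'.1 hu'.2.1 hu'.2.2).trans (Nat.pow_le_pow_right two_pos ?_)
          have h := dist_le (W.take (j u))
          have hlen' : (W.take (j u)).length ≤ j u := by simp [Walk.take_length]
          calc G.dist u g = G.dist g (W.getVert (j u)) := by rw [(hj u hu).2, dist_comm]
            _ ≤ j u := h.trans hlen'
      _ = ∑ i ∈ (W.support.toFinset \ {g, t}).image j, 2 ^ i := (sum_image hinj).symm
      _ ≤ ∑ i ∈ Ico 1 W.length, 2 ^ i := by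
          refine sum_le_sum_of_subset fun i hi => ?_
          obtain ⟨u, hu, rfl⟩ := mem_image.1 hi
          exact (hj u hu).1
  have hgeom : ∑ i ∈ Ico 1 W.length, 2 ^ i + 2 = 2 ^ W.length := by
    have h := Nat.geomSum_eq (le_refl 2) W.length
    have h2 : 2 ≤ 2 ^ W.length := Nat.le_self_pow (by omega) 2
    rw [range_eq_Ico, sum_eq_sum_Ico_succ_bot (by omega)] at h
    simp at h
    omega
  omega

variable [Fintype V]

/-- The induction behind the stacking theorem. Here `p` is the current distribution and `c u` is
the number of original pebbles consumed to produce the pebbles now at `u`. -/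
theorem wSolvable_of_le_sum_cost (hG : G.Connected) {B : ℕ}
    (hB : ∀ f, ∑ u, 2 ^ G.dist u f ≤ B) (p c : V → ℕ)
    (hfat : ∀ u, 2 ≤ p u → c u = p u) (hthin : ∀ u, p u = 0 → c u = 0)
    (hcost : ∀ f, 2 ≤ p f → ∀ u, p u ≤ 1 → c u ≤ 2 ^ G.dist u f)
    (hlast : ∃ f, ∀ u, p u ≤ 1 → c u ≤ 2 ^ G.dist u f) (hc : B ≤ ∑ u, c u) :
    G.WSolvable (fun _ => 1) p := by
  classical
  induction hk : ∑ u, p u using Nat.strong_induction_on generalizing p c with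
  | _ k ih =>
  subst hk
  by_cases hcov : ∀ v, 1 ≤ p v
  · exact ⟨p, .refl, hcov⟩
  push Not at hcov
  obtain ⟨t₀, ht₀⟩ := hcov
  by_cases hex : ∀ g, p g ≤ 1
  · obtain ⟨f, hf⟩ := hlast
    have hlt : ∑ u, c u < ∑ u, 2 ^ G.dist u f :=
      sum_lt_sum (fun u _ => hf u (hex u))
        ⟨t₀, mem_univ _, by rw [hthin t₀ (by omega)]; positivity⟩
    have := hB f
    omega
  push Not at hex
  obtain ⟨g₀, hg₀⟩ := hex
  obtain ⟨⟨g, t⟩, hgt, hmin⟩ := exists_min_image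
    (univ.filter fun x : V × V => 2 ≤ p x.1 ∧ p x.2 = 0) (fun x => G.dist x.1 x.2)
    ⟨(g₀, t₀), by simp; omega⟩
  simp only [mem_filter, mem_univ, true_and, Prod.forall] at hgt hmin
  obtain ⟨hg, ht⟩ := hgt
  have hne : g ≠ t := by rintro rfl; omega
  obtain ⟨W, hW, hlen⟩ := hG.exists_path_of_dist g t
  set I := W.support.toFinset \ {g, t} with hI
  have hint : ∀ u ∈ I, u ≠ g ∧ u ≠ t ∧ p u = 1 := by
    intro u hu
    simp only [hI, mem_sdiff, List.mem_toFinset, mem_insert, mem_singleton, not_or] at hu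
    obtain ⟨hu, hug, hut⟩ := hu
    refine ⟨hug, hut, ?_⟩
    have h1 := dist_le (W.takeUntil u hu)
    have h2 := dist_le (W.dropUntil u hu)
    have h3 : (W.takeUntil u hu).length + (W.dropUntil u hu).length = W.length := by
      rw [← Walk.length_append, Walk.take_spec]
    have h4 := hG.pos_dist_of_ne hug
    have h5 := hG.pos_dist_of_ne hut
    rw [dist_comm] at h4
    by_contra hpu
    rcases Nat.lt_or_ge (p u) 2 with h | h
    · have := hmin g u ⟨hg, by omega⟩
      omega
    · have := hmin u t ⟨h, ht⟩
      omega
  have hgI : g ∉ I := by simp [hI]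
  have htI : t ∉ I := by simp [hI]
  have hsum := W.sum_interior_add_two_le hne c (fun u hu hug hut => hcost g hg u (by
    rw [(hint u (by simp [hI, hu, hug, hut])).2.2]))
  rw [← hI, hlen] at hsum
  set p' : V → ℕ := fun u => if u = t then 1 else if u = g then p g - 2 else
    if u ∈ I then 0 else p u with hp'
  set c' : V → ℕ := fun u => if u = t then ∑ x ∈ I, c x + 2 else if u = g then p g - 2 else
    if u ∈ I then 0 else c u with hc'
  have hreach : Relation.ReflTransGen G.PebblingMove p p' := by
    have h := hW.reflTransGen_pebblingMove (fun u => if u = g then p u - 1 else p u) (by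
      intro u hu hut
      by_cases hug : u = g
      · subst hug; simp; omega
      · simp [hug, (hint u (by simp [hI, hu, hug, hut])).2.2])
    convert h using 2 with u u
    · by_cases hug : u = g
      · subst hug; simp; omega
      · simp [hug]
    · simp only [hp']
      by_cases hut : u = t
      · subst hut; simp [hne.symm, ht]
      · by_cases hug : u = g
        · subst hug; simp [hut]; omega
        · by_cases huI : u ∈ I
          · have hus : u ∈ W.support := by simp [hI] at huI; exact huI.1
            simp [hut, hug, huI, hus, (hint u huI).2.2]
          · have hus : u ∉ W.support := fun h => huI (by simp [hI, h, hug, hut])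
            simp [hut, hug, huI, hus]
  have hsplit : ∀ F : V → ℕ, ∑ u, F u = F t + (F g + (∑ u ∈ I, F u +
      ∑ u ∈ (univ \ insert t (insert g I)), F u)) := by
    intro F
    rw [← sum_sdiff (subset_univ (insert t (insert g I))), sum_insert, sum_insert hgI]
    · ring
    · simp [htI, hne.symm]
  have hrest : ∀ F F' : V → ℕ, (∀ u, u ≠ t → u ≠ g → u ∉ I → F u = F' u) →
      ∑ u ∈ (univ \ insert t (insert g I)), F u = ∑ u ∈ (univ \ insert t (insert g I)), F' u := by
    intro F F' h
    refine sum_congr rfl fun u hu => ?_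
    simp only [mem_sdiff, mem_univ, true_and, mem_insert, not_or] at hu
    exact h u hu.1 hu.2.1 hu.2.2
  have hzero : ∀ F : V → ℕ, (∀ u ∈ I, F u = 0) → ∑ u ∈ I, F u = 0 := fun F => sum_eq_zero
  have hInt : ∀ u ∈ I, u ≠ t ∧ u ≠ g := fun u hu => ⟨(hint u hu).2.1, (hint u hu).1⟩
  have hpsum : ∑ u, p' u < ∑ u, p u := by
    rw [hsplit p, hsplit p', hrest p' p (fun u h1 h2 h3 => by simp [hp', h1, h2, h3]),
      hzero p' (fun u hu => by simp [hp', hu, hInt u hu])]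
    have h1 : p' t = 1 := by simp [hp']
    have h2 : p' g = p g - 2 := by simp [hp', hne]
    omega
  have hcsum : ∑ u, c' u = ∑ u, c u := by
    rw [hsplit c, hsplit c', hrest c' c (fun u h1 h2 h3 => by simp [hc', h1, h2, h3]),
      hzero c' (fun u hu => by simp [hc', hu, hInt u hu])]
    have h1 : c' t = ∑ x ∈ I, c x + 2 := by simp [hc']
    have h2 : c' g = p g - 2 := by simp [hc', hne]
    have h3 := hfat g hg
    have h4 := hthin t ht
    omega
  have hbound : ∀ f, 2 ≤ p f → ∀ u, p' u ≤ 1 → c' u ≤ 2 ^ G.dist u f := by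
    intro f hf u hu
    simp only [hp', hc'] at hu ⊢
    split_ifs at hu ⊢ with h1 h2 h3
    · subst h1
      have := hmin f u ⟨hf, ht⟩
      rw [G.dist_comm (u := u)]
      exact hsum.trans (Nat.pow_le_pow_right two_pos this)
    · exact hu.trans Nat.one_le_two_pow
    · exact Nat.zero_le _
    · exact hcost f hf u hu
  have hfat' : ∀ f, 2 ≤ p' f → 2 ≤ p f ∧ c' f = p' f := by
    intro f hf
    simp only [hp', hc'] at hf ⊢
    split_ifs at hf ⊢ with h1 h2 h3
    · omega
    · subst h2; exact ⟨hg, rfl⟩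
    · omega
    · exact ⟨hf, hfat f hf⟩
  obtain ⟨q, hq, hcover⟩ := ih _ hpsum p' c' (fun u hu => (hfat' u hu).2)
    (by
      intro u hu
      simp only [hp', hc'] at hu ⊢
      split_ifs at hu ⊢ with h1 h2 h3
      · exact hu
      · rfl
      · exact hthin u hu)
    (fun f hf => hbound f (hfat' f hf).1) ⟨g, hbound g hg⟩ (hcsum ▸ hc) rfl
  exact ⟨q, hreach.trans hq, hcover⟩

/-- Upper bound in the stacking theorem. -/
theorem wSolvable_of_le_sum (hG : G.Connected) {p : V → ℕ}
    (hp : ∀ f, ∑ u, 2 ^ G.dist u f ≤ ∑ u, p u) : G.WSolvable (fun _ => 1) p :=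
  wSolvable_of_le_sum_cost hG hp p p (fun _ _ => rfl) (fun _ h => h)
    (fun _ _ _ hu => hu.trans Nat.one_le_two_pow)
    ⟨hG.nonempty.some, fun _ hu => hu.trans Nat.one_le_two_pow⟩ le_rfl

/-- A pebbling move does not increase the weight `∑ u, p u * 2 ^ φ u` if `φ` is 1-Lipschitz. -/
theorem PebblingMove.sum_mul_two_pow_le_s10 {φ : V → ℕ} (hφ : ∀ u v, G.Adj u v → φ v ≤ φ u + 1)
    {p q : V → ℕ} (h : G.PebblingMove p q) : ∑ u, q u * 2 ^ φ u ≤ ∑ u, p u * 2 ^ φ u := by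
  classical
  obtain ⟨u, v, huv, hpu, hqu, hqv, hq⟩ := h
  have hsplit : ∀ F : V → ℕ, ∑ x, F x = F u + (F v + ∑ x ∈ univ \ {u, v}, F x) := by
    intro F
    rw [← sum_sdiff (subset_univ {u, v}), sum_pair huv.ne]
    ring
  have hrest : ∑ x ∈ univ \ {u, v}, q x * 2 ^ φ x = ∑ x ∈ univ \ {u, v}, p x * 2 ^ φ x := by
    refine sum_congr rfl fun x hx => ?_
    simp only [mem_sdiff, mem_univ, true_and, mem_insert, mem_singleton, not_or] at hx
    rw [hq x hx.1 hx.2]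
  rw [hsplit, hsplit (fun x => p x * 2 ^ φ x), hrest, hqu, hqv]
  obtain ⟨k, hk⟩ := Nat.exists_eq_add_of_le hpu
  have hpow : 2 ^ φ v ≤ 2 ^ (φ u + 1) := Nat.pow_le_pow_right two_pos (hφ u v huv)
  rw [pow_succ] at hpow
  rw [hk, Nat.add_sub_cancel_left]
  nlinarith

/-- Lower bound in the stacking theorem: a stack that is too small admits no cover. -/
theorem not_wSolvable_single [DecidableEq V] {φ : V → ℕ}
    (hφ : ∀ u v, G.Adj u v → φ v ≤ φ u + 1) {f : V} (hf : φ f = 0) {N : ℕ}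
    (hN : N < ∑ u, 2 ^ φ u) : ¬ G.WSolvable (fun _ => 1) (Pi.single f N) := by
  rintro ⟨q, hq, hcov⟩
  have hle : ∑ u, q u * 2 ^ φ u ≤ ∑ u, (Pi.single f N : V → ℕ) u * 2 ^ φ u := by
    clear hcov
    induction hq with
    | refl => exact le_rfl
    | tail _ h ih => exact (h.sum_mul_two_pow_le_s10 hφ).trans ih
  have hstart : ∑ u, (Pi.single f N : V → ℕ) u * 2 ^ φ u = N := by
    rw [sum_eq_single f (fun u _ hu => by simp [hu]) (by simp)]
    simp [hf]
  have hend : ∑ u, 2 ^ φ u ≤ ∑ u, q u * 2 ^ φ u :=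
    sum_le_sum fun u _ => Nat.le_mul_of_pos_left _ (hcov u)
  omega

theorem coverPebblingNumber_eq_of_dist_le (hG : G.Connected) {φ : V → ℕ}
    (hφ : ∀ u v, G.Adj u v → φ v ≤ φ u + 1) {f : V} (hf : φ f = 0)
    (hle : ∀ f, ∑ u, 2 ^ G.dist u f ≤ ∑ u, 2 ^ φ u) :
    G.coverPebblingNumber (fun _ => 1) = ∑ u, 2 ^ φ u := by
  classical
  refine le_antisymm (Nat.sInf_le fun p hp => wSolvable_of_le_sum hG fun f => hp ▸ hle f)
    (le_csInf ⟨_, fun p hp => wSolvable_of_le_sum hG fun f => hp ▸ hle f⟩ fun N hN => ?_)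
  by_contra! hlt
  exact not_wSolvable_single hφ hf hlt (hN _ (by simp))

theorem dist_cycleGraph_add_nsmul_le {m : ℕ} (a : Fin (m + 2)) (j : ℕ) :
    (cycleGraph (m + 2)).dist a (a + j • 1) ≤ j := by
  induction j with
  | zero => simp
  | succ j ih =>
    refine cycleGraph_connected.dist_triangle (v := a + j • 1) |>.trans ?_
    refine add_le_add ih (le_of_eq ?_)
    rw [dist_eq_one_iff_adj, cycleGraph_adj]
    right
    rw [succ_nsmul]
    abel

theorem val_nsmul_one {m : ℕ} (j : ℕ) : (j • (1 : Fin (m + 2))).val = j % (m + 2) := by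
  induction j with
  | zero => simp
  | succ j ih => rw [succ_nsmul, Fin.val_add, ih, Fin.val_one, Nat.mod_add_mod]

theorem dist_cycleGraph_add_le {m : ℕ} (f x : Fin (m + 2)) :
    (cycleGraph (m + 2)).dist (x + f) f ≤ min x.val (m + 2 - x.val) := by
  have hx : x.val • (1 : Fin (m + 2)) = x := by
    ext
    rw [val_nsmul_one, Nat.mod_eq_of_lt x.isLt]
  refine le_min ?_ ?_
  · have h := dist_cycleGraph_add_nsmul_le f x.val
    rw [hx, dist_comm, add_comm f x] at h
    exact h
  · have h := dist_cycleGraph_add_nsmul_le (x + f) (m + 2 - x.val)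
    have hneg : (m + 2 - x.val) • (1 : Fin (m + 2)) = -x := by
      rw [eq_neg_iff_add_eq_zero]
      nth_rewrite 2 [← hx]
      rw [← add_nsmul, Nat.sub_add_cancel x.isLt.le]
      ext
      rw [val_nsmul_one, Nat.mod_self, Fin.val_zero]
    rw [hneg, add_comm x f, add_neg_cancel_right] at h
    rwa [add_comm x f]

theorem min_val_le_of_cycleGraph_adj {m : ℕ} {u v : Fin (m + 2)}
    (h : (cycleGraph (m + 2)).Adj u v) :
    min v.val (m + 2 - v.val) ≤ min u.val (m + 2 - u.val) + 1 := by
  rw [cycleGraph_adj] at h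
  have key : ∀ a b : Fin (m + 2), a - b = 1 → a.val = b.val + 1 ∨ (a.val = 0 ∧ b.val = m + 1) := by
    intro a b hab
    rw [sub_eq_iff_eq_add'] at hab
    subst hab
    rw [Fin.val_add]
    have := b.isLt
    rcases Nat.lt_or_ge (b.val + 1) (m + 2) with h | h
    · left
      simp [Nat.mod_eq_of_lt h]
    · right
      have : b.val = m + 1 := by omega
      simp [this]
  rcases h with h | h <;> rcases key _ _ h with h | h <;> omega

theorem sum_two_pow_min_odd (k : ℕ) :
    ∑ x : Fin (2 * k + 1), 2 ^ min x.val (2 * k + 1 - x.val) = 2 ^ (k + 2) - 3 := by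
  rw [Fin.sum_univ_eq_sum_range (fun x => 2 ^ min x (2 * k + 1 - x)),
    show 2 * k + 1 = (k + 1) + k by ring, sum_range_add]
  have h1 : ∑ x ∈ range (k + 1), 2 ^ min x (k + 1 + k - x) = 2 ^ (k + 1) - 1 := by
    have h := Nat.geomSum_eq (le_refl 2) (k + 1)
    simp only [Nat.add_one_sub_one, Nat.div_one] at h
    rw [← h]
    refine sum_congr rfl fun x hx => ?_
    rw [mem_range] at hx
    congr 1
    omega
  have h2 : ∑ x ∈ range k, 2 ^ min (k + 1 + x) (k + 1 + k - (k + 1 + x)) = 2 * (2 ^ k - 1) := by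
    have h := Nat.geomSum_eq (le_refl 2) k
    simp only [Nat.add_one_sub_one, Nat.div_one] at h
    rw [← h, ← sum_range_reflect, mul_sum]
    refine sum_congr rfl fun x hx => ?_
    rw [mem_range] at hx
    rw [← pow_succ']
    congr 1
    omega
  rw [h1, h2]
  have : 1 ≤ 2 ^ k := Nat.one_le_two_pow
  rw [pow_succ, pow_succ]
  omega

end SimpleGraph

/-- The cover pebbling number of the cycle graph on `2n - 1` vertices (`n ≥ 2`) is
`2^(n+1) - 3`. -/
theorem coverPebblingNumber_cycleGraph_odd (n : ℕ) (hn : 2 ≤ n) :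
    (SimpleGraph.cycleGraph (2 * n - 1)).coverPebblingNumber (fun _ => 1) =
      2 ^ (n + 1) - 3 := by
  obtain ⟨k, rfl⟩ := Nat.exists_eq_add_of_le hn
  have hm : 2 * (2 + k) - 1 = 2 * k + 1 + 2 := by omega
  rw [hm]
  rw [SimpleGraph.coverPebblingNumber_eq_of_dist_le SimpleGraph.cycleGraph_connected
    (φ := fun x => min x.val (2 * k + 1 + 2 - x.val)) (f := 0)
    (fun _ _ h => SimpleGraph.min_val_le_of_cycleGraph_adj h) (by simp)]
  · rw [show 2 + k + 1 = k + 1 + 2 by omega]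
    exact SimpleGraph.sum_two_pow_min_odd (k + 1)
  · intro f
    rw [← Equiv.sum_comp (Equiv.addRight f)]
    exact Finset.sum_le_sum fun x _ =>
      Nat.pow_le_pow_right two_pos (SimpleGraph.dist_cycleGraph_add_le f x)
end

section
/- For n ≥ 1, the cover pebbling number of the complete graph Kₙ on n vertices equals 2n − 1. -/
namespace SimpleGraph

variable {V : Type*} {G : SimpleGraph V}

/-- A weight that at most doubles along every edge gives a total weight that no pebbling move
increases. -/
theorem PebblingMove.weight_le [Fintype V] {c p q : V → ℕ}
    (hc : ∀ u v, G.Adj u v → c v ≤ 2 * c u) (h : G.PebblingMove p q) :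
    ∑ x, c x * q x ≤ ∑ x, c x * p x := by
  classical
  obtain ⟨u, v, huv, hu, hqu, hqv, hq⟩ := h
  have key : ∑ x, (c x * q x + if x = u then 2 * c u else 0) =
      ∑ x, (c x * p x + if x = v then c v else 0) := by
    refine Finset.sum_congr rfl fun x _ => ?_
    by_cases hxu : x = u
    · subst hxu
      obtain ⟨k, hk⟩ := Nat.exists_eq_add_of_le hu
      rw [hqu, hk, if_pos rfl, if_neg huv.ne, Nat.add_sub_cancel_left]
      ring
    · by_cases hxv : x = v
      · subst hxv
        rw [hqv, if_neg hxu, if_pos rfl]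
        ring
      · rw [hq x hxu hxv, if_neg hxu, if_neg hxv]
  simp only [Finset.sum_add_distrib, Finset.sum_ite_eq', Finset.mem_univ, if_true] at key
  have := hc u v huv
  omega

theorem weight_le_of_wSolvable [Fintype V] {c w p : V → ℕ}
    (hc : ∀ u v, G.Adj u v → c v ≤ 2 * c u) (h : G.WSolvable w p) :
    ∑ x, c x * w x ≤ ∑ x, c x * p x := by
  obtain ⟨q, hpq, hq⟩ := h
  refine (Finset.sum_le_sum fun x _ => Nat.mul_le_mul_left (c x) (hq x)).trans ?_
  clear hq
  induction hpq with
  | refl => exact le_rfl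
  | tail _ hmove ih => exact (hmove.weight_le hc).trans ih

/-- On a complete graph a distribution can be turned into a cover as soon as the number of moves
available while keeping a pebble on every occupied vertex is at least the number of empty
vertices. -/
theorem wSolvable_top_of_card_empty_le [Fintype V] (p : V → ℕ)
    (h : ∑ x, (if p x = 0 then 1 else 0) ≤ ∑ x, (p x - 1) / 2) :
    (⊤ : SimpleGraph V).WSolvable (fun _ => 1) p := by
  classical
  induction hk : ∑ x, (if p x = 0 then 1 else 0) generalizing p with
  | zero =>
    refine ⟨p, .refl, fun v => Nat.one_le_iff_ne_zero.2 fun hv => ?_⟩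
    simpa [hv] using Finset.sum_eq_zero_iff.1 hk v (Finset.mem_univ v)
  | succ k ih =>
    obtain ⟨v, -, hv⟩ := Finset.exists_ne_zero_of_sum_ne_zero (hk.trans_ne k.succ_ne_zero)
    obtain ⟨u, -, hu⟩ := Finset.exists_ne_zero_of_sum_ne_zero
      (show ∑ x, (p x - 1) / 2 ≠ 0 by omega)
    have hv : p v = 0 := by simpa using hv
    have hu : 3 ≤ p u := by omega
    have huv : u ≠ v := by rintro rfl; omega
    set q : V → ℕ := Function.update (Function.update p u (p u - 2)) v 1 with hq
    have hqv : q v = 1 := by simp [hq]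
    have hqu : q u = p u - 2 := by simp [hq, huv]
    have hqx (x) (hxu : x ≠ u) (hxv : x ≠ v) : q x = p x := by simp [hq, hxu, hxv]
    have hempty : ∑ x, ((if q x = 0 then 1 else 0) + if x = v then 1 else 0) =
        ∑ x, (if p x = 0 then 1 else 0) := by
      refine Finset.sum_congr rfl fun x _ => ?_
      grind
    have hmoves : ∑ x, ((q x - 1) / 2 + if x = u then 1 else 0) = ∑ x, (p x - 1) / 2 := by
      refine Finset.sum_congr rfl fun x _ => ?_
      grind
    simp only [Finset.sum_add_distrib, Finset.sum_ite_eq', Finset.mem_univ, if_true]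
      at hempty hmoves
    obtain ⟨r, hqr, hr⟩ := ih q (by omega) (by omega)
    exact ⟨r, .head ⟨u, v, huv, by omega, hqu, by rw [hqv, hv], hqx⟩ hqr, hr⟩

theorem wSolvable_top_of_two_mul_card_le [Fintype V] (p : V → ℕ)
    (h : 2 * Fintype.card V ≤ ∑ x, p x + 1) :
    (⊤ : SimpleGraph V).WSolvable (fun _ => 1) p := by
  refine wSolvable_top_of_card_empty_le p ?_
  have key : ∑ x, (p x + 2 * if p x = 0 then 1 else 0) ≤ ∑ x, (2 * ((p x - 1) / 2) + 2) :=
    Finset.sum_le_sum fun x _ => by split_ifs <;> omega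
  simp only [Finset.sum_add_distrib, ← Finset.mul_sum, Finset.sum_const, Finset.card_univ,
    smul_eq_mul] at key
  omega

theorem two_mul_card_le_of_wSolvable_single [Fintype V] [DecidableEq V] (a : V) {m : ℕ}
    (h : G.WSolvable (fun _ => 1) (Pi.single a m)) : 2 * Fintype.card V ≤ m + 1 := by
  have hle := weight_le_of_wSolvable (c := fun x => if x = a then 1 else 2)
    (fun u v _ => by split_ifs <;> omega) h
  have hright : ∑ x, (if x = a then 1 else 2) * (Pi.single a m : V → ℕ) x = m := by
    rw [Finset.sum_eq_single a (by simp +contextual) (by simp)]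
    simp
  have hleft : ∑ x : V, ((if x = a then 1 else 2) + if x = a then 1 else 0) = ∑ _x : V, 2 :=
    Finset.sum_congr rfl fun x _ => by split_ifs <;> rfl
  simp only [Finset.sum_add_distrib, Finset.sum_ite_eq', Finset.mem_univ, if_true,
    Finset.sum_const, Finset.card_univ, smul_eq_mul] at hleft
  simp only [mul_one] at hle
  omega

end SimpleGraph

/-- The cover pebbling number of the complete graph on `n ≥ 1` vertices is `2n - 1`. -/
theorem coverPebblingNumber_completeGraph (n : ℕ) (hn : 1 ≤ n) :
    (⊤ : SimpleGraph (Fin n)).coverPebblingNumber (fun _ => 1) = 2 * n - 1 := by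
  refine IsLeast.csInf_eq ⟨fun p hp => ?_, fun m hm => ?_⟩
  · refine SimpleGraph.wSolvable_top_of_two_mul_card_le p ?_
    rw [hp, Fintype.card_fin]
    omega
  · have := SimpleGraph.two_mul_card_le_of_wSolvable_single (⟨0, hn⟩ : Fin n)
      (hm (Pi.single ⟨0, hn⟩ m) (by simp))
    rw [Fintype.card_fin] at this
    omega
end
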